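/- Assume player 1's information is semi-standard. Then there exist a finite subset {x_ℓ : ℓ ∈ 𝓛} of 𝒳 and polytopes 𝒴_ℓ ⊆ 𝒴 (ℓ ∈ 𝓛) such that: (i) for every ℓ and every y ∈ 𝒴_ℓ, x_ℓ maximizes x ↦ min_{U∈Φ(y)} ⟨x,U⟩ over 𝒳; (ii) the union of the 𝒴_ℓ equals 𝒴; and (iii) for ℓ ≠ ℓ', the intersection 𝒴_ℓ ∩ 𝒴_{ℓ'} has empty interior relative to the affine hull of 𝒴 (so {𝒴_ℓ : ℓ ∈ 𝓛} forms a polytopial complex of 𝒴). -/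

import Mathlib

/-- The uncertainty correspondence `Φ`. -/
def Phi {A B : Type*} [Fintype A] [Fintype B] {d : ℕ} (u : A → B → ℝ)
    (H : A → B → Fin d → ℝ) (y : B → ℝ) : Set (A → ℝ) :=
  {U | ∃ y' ∈ stdSimplex ℝ B, (∀ a j, ∑ b, y' b * H a b j = ∑ b, y b * H a b j) ∧
    U = fun a => ∑ b, y' b * u a b}

/-- `inf1 S x = inf_{U ∈ S} ⟨x,U⟩`. -/
noncomputable def inf1 {n : Type*} [Fintype n] (S : Set (n → ℝ)) (x : n → ℝ) : ℝ :=
  sInf ((fun U => ∑ i, x i * U i) '' S)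

/-- `S` has empty interior relative to the affine hull of `P`. -/
def EmptyIntRel {n : Type*} [Fintype n] (P S : Set (n → ℝ)) : Prop :=
  interior ((↑) ⁻¹' S : Set (affineSpan ℝ P)) = ∅

open Filter Topology in
/-- A point that is extreme in a polyhedron is determined by its set of active constraints. -/
theorem eq_of_mem_extremePoints_of_active_iff {E ι : Type*} [AddCommGroup E] [Module ℝ E]
    [Finite ι] {f : ι → E →ₗ[ℝ] ℝ} {r : ι → ℝ} {z w : E}
    (hz : z ∈ Set.extremePoints ℝ {z | ∀ j, f j z ≤ r j}) (hw : ∀ j, f j w ≤ r j)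
    (hzw : ∀ j, f j z = r j → f j w = r j) : w = z := by
  have hev : ∀ᶠ ε : ℝ in 𝓝[>] 0, ∀ j, f j z + ε * (f j z - f j w) ≤ r j := by
    rw [eventually_all]
    intro j
    rcases (hz.1 j).eq_or_lt with h | h
    · simp [hzw j h, h]
    · have hcont : Continuous fun ε : ℝ => f j z + ε * (f j z - f j w) := by fun_prop
      have hlim : Tendsto (fun ε : ℝ => f j z + ε * (f j z - f j w)) (𝓝 0) (𝓝 (f j z)) := by
        simpa using hcont.tendsto 0
      exact ((hlim.eventually_lt_const h).mono fun _ => le_of_lt).filter_mono nhdsWithin_le_nhds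
  obtain ⟨ε, hε, hpos⟩ := (hev.and self_mem_nhdsWithin).exists
  have hpos : 0 < ε := hpos
  refine hz.2 (x₁ := w) hw (x₂ := z + ε • (z - w)) (fun j => by simpa using hε j) ?_
  refine ⟨ε / (1 + ε), 1 / (1 + ε), by positivity, by positivity, by field_simp; ring, ?_⟩
  have h1 : 1 + ε ≠ 0 := by positivity
  match_scalars <;> field_simp
  ring

/-- A polyhedron has finitely many extreme points. -/
theorem finite_extremePoints_polyhedron {E ι : Type*} [AddCommGroup E] [Module ℝ E]
    [Finite ι] (f : ι → E →ₗ[ℝ] ℝ) (r : ι → ℝ) :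
    (Set.extremePoints ℝ {z | ∀ j, f j z ≤ r j}).Finite := by
  refine Set.Finite.of_injOn (f := fun z => {j | f j z = r j}) (t := Set.univ)
    (fun _ _ => Set.mem_univ _) ?_ Set.finite_univ
  intro z hz w hw h
  exact (eq_of_mem_extremePoints_of_active_iff hz hw.1 fun j hj =>
    (Set.ext_iff.1 h j).1 hj).symm

/-- The part of the standard simplex cut out by finitely many homogeneous linear inequalities is
a polytope. -/
theorem exists_finset_convexHull_eq_stdSimplex_inter {n ι : Type*} [Fintype n] [Finite ι]
    (f : ι → (n → ℝ) →ₗ[ℝ] ℝ) :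
    ∃ F : Finset (n → ℝ),
      {z | z ∈ stdSimplex ℝ n ∧ ∀ j, f j z ≤ 0} = convexHull ℝ (F : Set (n → ℝ)) := by
  set K : Set (n → ℝ) := {z | z ∈ stdSimplex ℝ n ∧ ∀ j, f j z ≤ 0} with hK
  let S : (n → ℝ) →ₗ[ℝ] ℝ := ∑ i, LinearMap.proj i
  let g : (n ⊕ Bool) ⊕ ι → (n → ℝ) →ₗ[ℝ] ℝ :=
    Sum.elim (Sum.elim (fun i => -LinearMap.proj i) fun t => if t then S else -S) f
  let r : (n ⊕ Bool) ⊕ ι → ℝ :=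
    Sum.elim (Sum.elim (fun _ => 0) fun t => if t then 1 else -1) fun _ => 0
  have hKg : K = {z | ∀ j, g j z ≤ r j} := by
    ext z
    simp only [hK, Set.mem_ofPred_eq, stdSimplex, g, r, S, Sum.forall, Sum.elim_inl, Sum.elim_inr,
      Bool.forall_bool, if_true, LinearMap.neg_apply, LinearMap.proj_apply,
      LinearMap.sum_apply, Bool.false_eq_true, if_false, neg_le_neg_iff, neg_nonpos,
      le_antisymm_iff (b := (1 : ℝ))]
    tauto
  have hclosed : IsClosed {z : n → ℝ | ∀ j, f j z ≤ 0} := by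
    simp only [Set.ofPred_forall]
    exact isClosed_iInter fun j =>
      isClosed_le (f j).continuous_of_finiteDimensional continuous_const
  have hconv : Convex ℝ K := by
    have hc : Convex ℝ {z : n → ℝ | ∀ j, f j z ≤ 0} := by
      simp only [Set.ofPred_forall]
      exact convex_iInter fun j => convex_halfSpace_le (f j).isLinear 0
    exact (convex_stdSimplex ℝ n).inter hc
  have hcomp : IsCompact K := (isCompact_stdSimplex ℝ n).inter_right hclosed
  have hfin : (Set.extremePoints ℝ K).Finite := by
    rw [hKg]; exact finite_extremePoints_polyhedron g r
  refine ⟨hfin.toFinset, ?_⟩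
  rw [Set.Finite.coe_toFinset, ← (hfin.isCompact_convexHull ℝ).isClosed.closure_eq,
    closure_convexHull_extremePoints hcomp hconv]

/-- Two distinct linear functionals agree on no relatively open part of the standard simplex. -/
theorem emptyIntRel_stdSimplex_of_forall_sum_eq {B : Type*} [Fintype B] {S : Set (B → ℝ)}
    {G G' : B → ℝ} (hG : G ≠ G') (hS : ∀ y ∈ S, ∑ b, y b * G b = ∑ b, y b * G' b) :
    EmptyIntRel (stdSimplex ℝ B) S := by
  classical
  rw [EmptyIntRel, Set.eq_empty_iff_forall_notMem]
  intro p hp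
  refine hG (funext fun b => ?_)
  have hb : Pi.single b (1 : ℝ) ∈ affineSpan ℝ (stdSimplex ℝ B) :=
    subset_affineSpan ℝ _ (single_mem_stdSimplex ℝ b)
  let γ : ℝ → affineSpan ℝ (stdSimplex ℝ B) := fun t =>
    ⟨AffineMap.lineMap (p : B → ℝ) (Pi.single b 1) t, AffineMap.lineMap_mem t p.2 hb⟩
  have hγ : Continuous γ := by
    refine Continuous.subtype_mk ?_ _
    exact AffineMap.lineMap_continuous
  have hγ0 : γ 0 = p := by ext; simp [γ]
  have hev : ∀ᶠ t in nhds (0 : ℝ), (γ t : B → ℝ) ∈ S := by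
    have : ∀ᶠ q : affineSpan ℝ (stdSimplex ℝ B) in nhds (γ 0), (q : B → ℝ) ∈ S := by
      rw [hγ0]; exact mem_interior_iff_mem_nhds.1 hp
    exact hγ.continuousAt.eventually this
  obtain ⟨t, ht, ht0⟩ :=
    ((hev.filter_mono nhdsWithin_le_nhds).and (self_mem_nhdsWithin (s := {(0 : ℝ)}ᶜ))).exists
  have h0 := hS _ (hγ0 ▸ hev.self_of_nhds)
  have h1 := hS _ ht
  simp only [γ, AffineMap.lineMap_apply_module, Pi.add_apply, Pi.smul_apply, smul_eq_mul,
    add_mul, Finset.sum_add_distrib, mul_assoc, ← Finset.mul_sum, h0] at h1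
  have h2 := mul_left_cancel₀ ht0 (add_left_cancel h1)
  simpa [Pi.single_apply] using h2

/-- Under semi-standard information, mixed actions with the same signals give the same weight to
every cell. -/
theorem sum_mul_comp_eq_of_signal_eq {A B I : Type*} [Fintype B] [Fintype I] {d : ℕ}
    {H : A → B → Fin d → ℝ} {c : B → I} {Hi : I → A → Fin d → ℝ}
    (hcell : ∀ b, (fun a => H a b) = Hi (c b)) (hind : LinearIndependent ℝ Hi) {y y' : B → ℝ}
    (h : ∀ a j, ∑ b, y' b * H a b j = ∑ b, y b * H a b j) (F : I → ℝ) :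
    ∑ b, y' b * F (c b) = ∑ b, y b * F (c b) := by
  classical
  have hw : ∀ i, ∑ b with c b = i, (y' b - y b) = 0 := by
    refine Fintype.linearIndependent_iff.1 hind _ ?_
    have : ∑ i, (∑ b with c b = i, (y' b - y b)) • Hi i = ∑ b, (y' b - y b) • Hi (c b) := by
      rw [← Finset.sum_fiberwise Finset.univ c]
      refine Finset.sum_congr rfl fun i _ => ?_
      rw [Finset.sum_smul]
      refine Finset.sum_congr rfl fun b hb => ?_
      rw [(Finset.mem_filter.1 hb).2]
    rw [this]
    ext a j
    simp only [← hcell, Finset.sum_apply, Pi.smul_apply, smul_eq_mul, sub_mul,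
      Finset.sum_sub_distrib, h a j, sub_self, Pi.zero_apply]
  rw [← sub_eq_zero, ← Finset.sum_sub_distrib, ← Finset.sum_fiberwise Finset.univ c]
  refine Finset.sum_eq_zero fun i _ => ?_
  calc _ = ∑ b with c b = i, (y' b - y b) * F i := by
        refine Finset.sum_congr rfl fun b hb => ?_
        rw [(Finset.mem_filter.1 hb).2, sub_mul]
    _ = 0 := by rw [← Finset.sum_mul, hw, zero_mul]

/-- The lowest payoff of the mixed action `x` against the actions in the cell of `b`. -/
noncomputable def cellMin {A B I : Type*} [Fintype A] (u : A → B → ℝ) (c : B → I)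
    (x : A → ℝ) (b : B) : ℝ :=
  ⨅ b' : {b' // c b' = c b}, ∑ a, x a * u a b'

section CellMin

variable {A B I : Type*} [Fintype A] (u : A → B → ℝ) (c : B → I) (x : A → ℝ)

theorem cellMin_le [Finite B] {b b' : B} (h : c b' = c b) : cellMin u c x b ≤ ∑ a, x a * u a b' :=
  ciInf_le (f := fun b' : {b' // c b' = c b} => ∑ a, x a * u a b') (Set.finite_range _).bddBelow
    ⟨b', h⟩

theorem exists_cellMin_eq [Finite B] (b : B) :
    ∃ b', c b' = c b ∧ ∑ a, x a * u a b' = cellMin u c x b := by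
  have : Nonempty {b' // c b' = c b} := ⟨⟨b, rfl⟩⟩
  obtain ⟨b', hb'⟩ :=
    exists_eq_ciInf_of_finite (f := fun b' : {b' // c b' = c b} => ∑ a, x a * u a b')
  exact ⟨b', b'.2, hb'⟩

theorem cellMin_eq [Finite B] {s b : B} (hs : c s = c b)
    (h : ∀ b', c b' = c b → ∑ a, x a * u a s ≤ ∑ a, x a * u a b') :
    cellMin u c x b = ∑ a, x a * u a s := by
  obtain ⟨b', hb', he⟩ := exists_cellMin_eq u c x b
  exact (cellMin_le u c x hs).antisymm (he ▸ h b' hb')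

theorem exists_cellMin_eq_comp : ∃ F : I → ℝ, ∀ b, cellMin u c x b = F (c b) :=
  ⟨fun i => ⨅ b' : {b' // c b' = i}, ∑ a, x a * u a b', fun _ => rfl⟩

end CellMin

/-- Under semi-standard information, the worst payoff of `x` compatible with the signals of `y`
is linear in `y`. -/
theorem inf1_Phi_eq {A B I : Type*} [Fintype A] [Fintype B] [Fintype I] {d : ℕ}
    (u : A → B → ℝ) {H : A → B → Fin d → ℝ} {c : B → I} {Hi : I → A → Fin d → ℝ}
    (hcell : ∀ b, (fun a => H a b) = Hi (c b))
    (hind : LinearIndependent ℝ Hi) {y : B → ℝ} (hy : y ∈ stdSimplex ℝ B) (x : A → ℝ) :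
    inf1 (Phi u H y) x = ∑ b, y b * cellMin u c x b := by
  classical
  have hpay : ∀ y' : B → ℝ,
      ∑ a, x a * ∑ b, y' b * u a b = ∑ b, y' b * ∑ a, x a * u a b := by
    intro y'
    simp only [Finset.mul_sum]
    rw [Finset.sum_comm]
    exact Finset.sum_congr rfl fun _ _ => Finset.sum_congr rfl fun _ _ => by ring
  refine IsLeast.csInf_eq ⟨?_, ?_⟩
  · choose s hsc hs using exists_cellMin_eq u c x
    have hpush : ∀ φ : B → ℝ,
        ∑ b, (∑ b', if s b' = b then y b' else 0) * φ b = ∑ b', y b' * φ (s b') := by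
      intro φ
      simp only [Finset.sum_mul]
      rw [Finset.sum_comm]
      simp
    refine ⟨_, ⟨fun b => ∑ b', if s b' = b then y b' else 0, ⟨fun b => ?_, ?_⟩, ?_, rfl⟩, ?_⟩
    · exact Finset.sum_nonneg fun b' _ => by split_ifs <;> simp [hy.1]
    · simpa [hy.2] using hpush fun _ => 1
    · intro a j
      rw [hpush fun b => H a b j]
      refine Finset.sum_congr rfl fun b _ => ?_
      have := (hcell (s b)).trans ((congrArg Hi (hsc b)).trans (hcell b).symm)
      rw [congrFun (congrFun this a) j]
    · exact (hpay _).trans ((hpush _).trans (by simp only [hs]))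
  · rintro _ ⟨_, ⟨y', hy', hH, rfl⟩, rfl⟩
    obtain ⟨F, hF⟩ := exists_cellMin_eq_comp u c x
    have hsum := sum_mul_comp_eq_of_signal_eq hcell hind hH F
    simp only [← hF] at hsum
    simp only [hpay, ← hsum]
    exact Finset.sum_le_sum fun b _ =>
      mul_le_mul_of_nonneg_left (cellMin_le u c x rfl) (hy'.1 b)

/-- Finitely many mixed actions suffice to maximize every cone combination of the cell minima. -/
theorem exists_finset_cellMin_dominating {A B I : Type*} [Fintype A] [Fintype B]
    (u : A → B → ℝ) (c : B → I) :
    ∃ E : Finset (A → ℝ), (∀ e ∈ E, e ∈ stdSimplex ℝ A) ∧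
      ∀ x ∈ stdSimplex ℝ A, ∀ y : B → ℝ,
        ∃ e ∈ E, ∑ b, y b * cellMin u c x b ≤ ∑ b, y b * cellMin u c e b := by
  classical
  let v : B → (A → ℝ) →ₗ[ℝ] ℝ := fun b => ∑ a, u a b • LinearMap.proj a
  have hv : ∀ b x, v b x = ∑ a, x a * u a b := by
    intro b x
    simp [v, mul_comm]
  have hpoly := fun s : B → B => exists_finset_convexHull_eq_stdSimplex_inter
    fun q : {q : B × B // c q.2 = c q.1} => v (s q.1.1) - v q.1.2
  choose F hF using hpoly
  let E := (Finset.univ.filter fun s : B → B => ∀ b, c (s b) = c b).biUnion F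
  have hmin : ∀ s : B → B, (∀ b, c (s b) = c b) → ∀ x ∈ convexHull ℝ (F s : Set (A → ℝ)),
      ∀ b, cellMin u c x b = v (s b) x := by
    intro s hs x hx b
    rw [← hF] at hx
    rw [hv]
    refine cellMin_eq u c x (hs b) fun b' hb' => ?_
    have := hx.2 ⟨(b, b'), hb'⟩
    simpa [hv] using this
  refine ⟨E, ?_, ?_⟩
  · intro e he
    obtain ⟨s, -, hes⟩ := Finset.mem_biUnion.1 he
    have : e ∈ convexHull ℝ (F s : Set (A → ℝ)) := subset_convexHull ℝ _ hes
    rw [← hF] at this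
    exact this.1
  · intro x hx y
    choose s hsc hs using exists_cellMin_eq u c x
    have hxs : x ∈ convexHull ℝ (F s : Set (A → ℝ)) := by
      rw [← hF]
      refine ⟨hx, fun q => ?_⟩
      have := cellMin_le u c x q.2
      simpa [hv, hs] using this
    let L : (A → ℝ) →ₗ[ℝ] ℝ := ∑ b, y b • v (s b)
    have hL : ∀ z ∈ convexHull ℝ (F s : Set (A → ℝ)), ∑ b, y b * cellMin u c z b = L z := by
      intro z hz
      simp [L, hmin s hsc z hz]
    obtain ⟨e, he, hle⟩ :=
      (L.convexOn (convex_convexHull ℝ _)).exists_ge_of_mem_convexHull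
        (subset_convexHull ℝ (F s : Set (A → ℝ))) hxs
    refine ⟨e, Finset.mem_biUnion.2 ⟨s, by simpa using hsc, he⟩, ?_⟩
    rwa [hL x hxs, hL e (subset_convexHull ℝ _ he)]

/-- under a semi-standard information structure for player 1, there exist a
finite family `(x_ℓ)` of points of `𝒳` and polytopes `𝒴_ℓ ⊆ 𝒴` such that: (i) for every `ℓ`
and every `y ∈ 𝒴_ℓ`, `x_ℓ` maximizes `x ↦ min_{U ∈ Φ(y)} ⟨x,U⟩` over `𝒳`; (ii) the union of
the `𝒴_ℓ` is `𝒴`; (iii) distinct `𝒴_ℓ, 𝒴_ℓ'` intersect in a set with empty interior relative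
to the affine hull of `𝒴`: they form a polytopial complex of `𝒴`. -/
theorem semistandard_best_reply_complex
    {A B I : Type*} [Fintype A] [Fintype B] [Fintype I] {d : ℕ}
    (u : A → B → ℝ) (H : A → B → Fin d → ℝ)
    (c : B → I) (hc : Function.Surjective c)
    (Hi : I → A → Fin d → ℝ)
    (hcell : ∀ b, (fun a => H a b) = Hi (c b))
    (hind : LinearIndependent ℝ Hi) :
    ∃ (N : ℕ) (xs : Fin N → (A → ℝ)) (Ys : Fin N → Set (B → ℝ)),
      (∀ ℓ, xs ℓ ∈ stdSimplex ℝ A) ∧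
      (∀ ℓ, ∃ F : Finset (B → ℝ), Ys ℓ = convexHull ℝ (F : Set (B → ℝ))) ∧
      (∀ ℓ, Ys ℓ ⊆ stdSimplex ℝ B) ∧
      (∀ ℓ, ∀ y ∈ Ys ℓ, xs ℓ ∈ stdSimplex ℝ A ∧
        ∀ x' ∈ stdSimplex ℝ A, inf1 (Phi u H y) x' ≤ inf1 (Phi u H y) (xs ℓ)) ∧
      (⋃ ℓ, Ys ℓ) = stdSimplex ℝ B ∧
      (∀ ℓ ℓ', ℓ ≠ ℓ' → EmptyIntRel (stdSimplex ℝ B) (Ys ℓ ∩ Ys ℓ')) := by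
  classical
  rcases isEmpty_or_nonempty B with hB | ⟨⟨b₀⟩⟩
  · have hempty : stdSimplex ℝ B = ∅ := stdSimplex_of_isEmpty_index ℝ B
    exact ⟨0, Fin.elim0, Fin.elim0, fun ℓ => ℓ.elim0, fun ℓ => ℓ.elim0, fun ℓ => ℓ.elim0,
      fun ℓ => ℓ.elim0, by simp [hempty], fun ℓ => ℓ.elim0⟩
  obtain ⟨a₀⟩ : Nonempty A := by
    by_contra hA
    rw [not_nonempty_iff] at hA
    exact hind.ne_zero (c b₀) (Subsingleton.elim _ _)
  obtain ⟨E, hE, hdom⟩ := exists_finset_cellMin_dominating u c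
  let P : Finset (B → ℝ) := E.image (cellMin u c)
  have hP : ∀ p : P, ∃ x ∈ stdSimplex ℝ A, cellMin u c x = p := by
    rintro ⟨p, hp⟩
    obtain ⟨e, he, rfl⟩ := Finset.mem_image.1 hp
    exact ⟨e, hE e he, rfl⟩
  choose ξ hξ hξp using hP
  let val : (B → ℝ) → (B → ℝ) →ₗ[ℝ] ℝ := fun p => ∑ b, p b • LinearMap.proj b
  have hval : ∀ p y, val p y = ∑ b, y b * p b := by
    intro p y
    simp [val, mul_comm]
  let Y : P → Set (B → ℝ) := fun p =>
    {y | y ∈ stdSimplex ℝ B ∧ ∀ q : P, (val q - val p) y ≤ 0}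
  have hYle : ∀ (p q : P), ∀ y ∈ Y p, ∑ b, y b * (q : B → ℝ) b ≤ ∑ b, y b * (p : B → ℝ) b := by
    intro p q y hy
    have := hy.2 q
    rwa [LinearMap.sub_apply, sub_nonpos, hval, hval] at this
  let e := P.equivFin.symm
  refine ⟨P.card, fun ℓ => ξ (e ℓ), fun ℓ => Y (e ℓ), fun ℓ => hξ _, fun ℓ => ?_,
    fun ℓ y hy => hy.1, fun ℓ y hy => ⟨hξ _, fun x hx => ?_⟩, ?_, fun ℓ ℓ' hne => ?_⟩
  · exact exists_finset_convexHull_eq_stdSimplex_inter _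
  · rw [inf1_Phi_eq u hcell hind hy.1, inf1_Phi_eq u hcell hind hy.1, hξp]
    obtain ⟨z, hz, hle⟩ := hdom x hx y
    exact hle.trans (hYle _ ⟨_, Finset.mem_image_of_mem _ hz⟩ y hy)
  · refine (Set.iUnion_subset fun ℓ y hy => hy.1).antisymm fun y hy => ?_
    obtain ⟨z, hz, -⟩ := hdom _ (single_mem_stdSimplex ℝ a₀) y
    have : Nonempty P := ⟨⟨_, Finset.mem_image_of_mem _ hz⟩⟩
    obtain ⟨p, hp⟩ := Finite.exists_max fun p : P => val p y
    refine Set.mem_iUnion.2 ⟨e.symm p, ?_⟩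
    simp only [Equiv.apply_symm_apply]
    exact ⟨hy, fun q => sub_nonpos.2 (hp q)⟩
  · refine emptyIntRel_stdSimplex_of_forall_sum_eq (G := (e ℓ : B → ℝ)) (G' := (e ℓ' : B → ℝ))
      (fun h => hne (e.injective (Subtype.ext h))) fun y hy => ?_
    exact (hYle _ _ y hy.2).antisymm (hYle _ _ y hy.1)
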